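/- arXiv:1609.04560 — 2 statements merged into one kernel-verified Lean document; each statement's English description precedes it below -/
import Mathlib

section
/- Let (P,Q,R,S) be a cycle of Lagrangians in a 2n-dimensional real symplectic vector space (V,ω), i.e. ⟨P,Q,R⟩, ⟨P,Q,S⟩, ⟨P,R,S⟩ and ⟨Q,R,S⟩ all hold. If L is a Lagrangian such that B_{P,Q} restricted to L is positive definite (M(P,L,Q) = n), then B_{R,S} restricted to L is negative definite (M(R,L,S) = −n). -/
open Module

/-- A Lagrangian subspace: an `n`-dimensional subspace on which `ω` vanishes identically. -/
def IsLagrangian {V : Type*} [AddCommGroup V] [Module ℝ V]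
    (ω : LinearMap.BilinForm ℝ V) (n : ℕ) (L : Submodule ℝ V) : Prop :=
  finrank ℝ L = n ∧ ∀ v ∈ L, ∀ w ∈ L, ω v w = 0

/-- The relation `⟨X,Y,Z⟩` on Lagrangians: `X` and `Z` are transverse and
`B_{X,Z}(y,y) > 0` for all nonzero `y ∈ Y`, where `B_{X,Z}(v,w) = ω(v, Inv_{X,Z} w)` and
`Inv_{X,Z}` is the reflection in the pair `(X,Z)`. -/
def MaslovMax {V : Type*} [AddCommGroup V] [Module ℝ V]
    (ω : LinearMap.BilinForm ℝ V) (X Y Z : Submodule ℝ V) : Prop :=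
  X ⊓ Z = ⊥ ∧ ∃ Inv : V →ₗ[ℝ] V, (∀ v ∈ X, Inv v = -v) ∧ (∀ v ∈ Z, Inv v = v) ∧
    ∀ y ∈ Y, y ≠ 0 → 0 < ω y (Inv y)

/-- Two `n`-dimensional subspaces with trivial intersection span a `2n`-dimensional space. -/
theorem exists_add_eq_of_inf_eq_bot {V : Type*} [AddCommGroup V] [Module ℝ V]
    [FiniteDimensional ℝ V] {n : ℕ} (hdim : finrank ℝ V = 2 * n) {X Z : Submodule ℝ V}
    (hX : finrank ℝ X = n) (hZ : finrank ℝ Z = n) (hXZ : X ⊓ Z = ⊥) (v : V) :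
    ∃ x ∈ X, ∃ z ∈ Z, x + z = v := by
  have htop : X ⊔ Z = ⊤ :=
    Submodule.eq_top_of_disjoint X Z (by omega) (disjoint_iff.mpr hXZ)
  exact Submodule.mem_sup.mp (htop ▸ Submodule.mem_top)

/-- The form `B_{X,Z}` at `x + z` equals `2 ω(x, z)`. -/
theorem apply_reflection_add {V : Type*} [AddCommGroup V] [Module ℝ V]
    {ω : LinearMap.BilinForm ℝ V} (halt : ∀ v : V, ω v v = 0) {X Z : Submodule ℝ V}
    {Inv : V →ₗ[ℝ] V} (hX : ∀ v ∈ X, Inv v = -v) (hZ : ∀ v ∈ Z, Inv v = v)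
    {x z : V} (hx : x ∈ X) (hz : z ∈ Z) : ω (x + z) (Inv (x + z)) = 2 * ω x z := by
  have hneg : -ω x z = ω z x := LinearMap.IsAlt.neg (B := ω) halt x z
  simp only [map_add, hX x hx, hZ z hz, LinearMap.add_apply, map_neg, halt]
  linarith

theorem MaslovMax.nonneg {V : Type*} [AddCommGroup V] [Module ℝ V]
    {ω : LinearMap.BilinForm ℝ V} (halt : ∀ v : V, ω v v = 0) {X Y Z : Submodule ℝ V}
    (h : MaslovMax ω X Y Z) {x z : V} (hx : x ∈ X) (hz : z ∈ Z) (hy : x + z ∈ Y) :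
    0 ≤ ω x z := by
  obtain ⟨-, Inv, hX, hZ, hpos⟩ := h
  have key := apply_reflection_add halt hX hZ hx hz
  by_cases h0 : x + z = 0
  · rw [h0] at key
    simp only [map_zero] at key
    linarith
  · have := hpos _ hy h0
    linarith

theorem MaslovMax.inf_eq_bot {V : Type*} [AddCommGroup V] [Module ℝ V]
    {ω : LinearMap.BilinForm ℝ V} (halt : ∀ v : V, ω v v = 0) {X Y Z : Submodule ℝ V}
    (h : MaslovMax ω X Y Z) : Y ⊓ Z = ⊥ := by
  obtain ⟨-, Inv, -, hZ, hpos⟩ := h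
  refine (Submodule.eq_bot_iff _).mpr fun y hy => ?_
  by_contra h0
  have := hpos y hy.1 h0
  rw [hZ y hy.2, halt] at this
  exact lt_irrefl _ this

/-- View Lagrangians transverse to `S` as symmetric forms on `P`, and let `Y` correspond to a
positive one. If `p + y` has `P`-component `p + p₁`, where `y = p₁ + s₁ ∈ Y`, then the form of `Y`
exceeds `ω(p + p₁, s₁)` at `p + p₁` by at least `ω(p, y)`. -/
theorem MaslovMax.add_le_apply {V : Type*} [AddCommGroup V] [Module ℝ V]
    {ω : LinearMap.BilinForm ℝ V} (halt : ∀ v : V, ω v v = 0) {P Y S : Submodule ℝ V}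
    (hP : ∀ v ∈ P, ∀ w ∈ P, ω v w = 0) (hY : ∀ v ∈ Y, ∀ w ∈ Y, ω v w = 0)
    (hS : ∀ v ∈ S, ∀ w ∈ S, ω v w = 0) (h : MaslovMax ω P Y S)
    {p p₁ s₁ s₂ : V} (hp : p ∈ P) (hp₁ : p₁ ∈ P) (hs₁ : s₁ ∈ S) (hs₂ : s₂ ∈ S)
    (hy₁ : p₁ + s₁ ∈ Y) (hy₂ : p + p₁ + s₂ ∈ Y) :
    ω (p + p₁) s₁ + ω p (p₁ + s₁) ≤ ω (p + p₁) s₂ := by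
  have hdiff : p + (s₂ - s₁) ∈ Y := by
    have := Y.sub_mem hy₂ hy₁
    rwa [show p + p₁ + s₂ - (p₁ + s₁) = p + (s₂ - s₁) by abel] at this
  have hnn := h.nonneg halt hp (S.sub_mem hs₂ hs₁) hdiff
  have hiso := hY _ hy₂ _ hy₁
  have hneg : -ω p₁ s₂ = ω s₂ p₁ := LinearMap.IsAlt.neg (B := ω) halt p₁ s₂
  simp only [map_add, map_sub, LinearMap.add_apply, hP p hp p₁ hp₁, halt,
    hS s₂ hs₂ s₁ hs₁] at hiso hnn ⊢
  linarith

/-- if `(P,Q,R,S)` is a cycle of Lagrangians and `L` is a Lagrangian with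
`M(P,L,Q) = n` (i.e. `B_{P,Q}` positive definite on `L`), then `M(R,L,S) = -n`
(i.e. `B_{R,S}` negative definite on `L`). -/
theorem disjointness_lemma {V : Type*} [AddCommGroup V] [Module ℝ V]
    [FiniteDimensional ℝ V]
    (n : ℕ) (hn : 1 ≤ n) (hdim : finrank ℝ V = 2 * n)
    (ω : LinearMap.BilinForm ℝ V)
    (halt : ∀ v : V, ω v v = 0)
    (hnd : ∀ v : V, (∀ w : V, ω v w = 0) → v = 0)
    (P Q R S : Submodule ℝ V)
    (hP : IsLagrangian ω n P) (hQ : IsLagrangian ω n Q)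
    (hR : IsLagrangian ω n R) (hS : IsLagrangian ω n S)
    (hPQR : MaslovMax ω P Q R) (hPQS : MaslovMax ω P Q S)
    (hPRS : MaslovMax ω P R S) (hQRS : MaslovMax ω Q R S)
    (L : Submodule ℝ V) (hL : IsLagrangian ω n L)
    (hPQ : P ⊓ Q = ⊥)
    (InvPQ : V →ₗ[ℝ] V)
    (hInvPQ₁ : ∀ v ∈ P, InvPQ v = -v) (hInvPQ₂ : ∀ v ∈ Q, InvPQ v = v)
    (hpos : ∀ v ∈ L, v ≠ 0 → 0 < ω v (InvPQ v))
    (hRS : R ⊓ S = ⊥)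
    (InvRS : V →ₗ[ℝ] V)
    (hInvRS₁ : ∀ v ∈ R, InvRS v = -v) (hInvRS₂ : ∀ v ∈ S, InvRS v = v) :
    ∀ v ∈ L, v ≠ 0 → ω v (InvRS v) < 0 := by
  intro v hv hv0
  obtain ⟨p, hp, q, hq, rfl⟩ := exists_add_eq_of_inf_eq_bot hdim hP.1 hQ.1 hPQ v
  have hpq : 0 < ω p q := by
    have := hpos _ hv hv0
    rw [apply_reflection_add halt hInvPQ₁ hInvPQ₂ hp hq] at this
    linarith
  obtain ⟨p₁, hp₁, s₁, hs₁, rfl⟩ := exists_add_eq_of_inf_eq_bot hdim hP.1 hS.1 hPRS.1 q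
  have hp₀ : p + p₁ ∈ P := P.add_mem hp hp₁
  obtain ⟨q', hq', s, hs, hqs⟩ :=
    exists_add_eq_of_inf_eq_bot hdim hQ.1 hS.1 (hPQS.inf_eq_bot halt) (p + p₁)
  obtain ⟨r, hr, t, ht, hrt⟩ := exists_add_eq_of_inf_eq_bot hdim hR.1 hS.1 hRS (p + p₁)
  have hQ' : p + p₁ + -s ∈ Q := by rwa [← hqs, add_neg_cancel_right]
  have hR' : p + p₁ + -t ∈ R := by rwa [← hrt, add_neg_cancel_right]
  have hLQ := hPQS.add_le_apply halt hP.2 hQ.2 hS.2 hp hp₁ hs₁ (S.neg_mem hs) hq hQ'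
  obtain ⟨p₂, hp₂, r₂, hr₂, hpr⟩ :=
    exists_add_eq_of_inf_eq_bot hdim hP.1 hR.1 hPQR.1 (p + p₁ + -s)
  have hpr_nonneg : 0 ≤ ω p₂ r₂ := hPQR.nonneg halt hp₂ hr₂ (hpr ▸ hQ')
  have hr₂_eq : r₂ = (p + p₁ - p₂) + -s := by
    rw [eq_sub_of_add_eq' hpr]; abel
  have hp₀_eq : p₂ + (p + p₁ - p₂) = p + p₁ := by abel
  have hQR := hPRS.add_le_apply halt hP.2 hR.2 hS.2 hp₂ (P.sub_mem hp₀ hp₂) (S.neg_mem hs)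
    (S.neg_mem ht) (hr₂_eq ▸ hr₂) (by rwa [hp₀_eq])
  rw [← hr₂_eq, hp₀_eq] at hQR
  have hv_eq : p + (p₁ + s₁) = (p + p₁ + -t) + (s₁ + t) := by abel
  rw [hv_eq, apply_reflection_add halt hInvRS₁ hInvRS₂ hR' (S.add_mem hs₁ ht)]
  have hst : ω (p + p₁ + -t) (s₁ + t) = ω (p + p₁) s₁ - ω (p + p₁) (-t) := by
    rw [map_add ω, LinearMap.add_apply, hS.2 _ (S.neg_mem ht) _ (S.add_mem hs₁ ht)]
    simp only [map_add, map_neg]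
    ring
  linarith
end

section
/- Let (V,ω) be a 2n-dimensional real symplectic vector space. The symplectic group acts transitively on triples of Lagrangians with maximal Maslov index: if (P,Q,R) and (P',Q',R') are two triples of Lagrangians with ⟨P,Q,R⟩ and ⟨P',Q',R'⟩, then there exists g ∈ Sp(V,ω) with gP = P', gQ = Q' and gR = R'. -/
open Module

/-- A positive definite symmetric bilinear form on a finite-dimensional real vector space is
isometric to the standard Euclidean inner product. -/
theorem exists_euclidean_isometry_of_posDef {W : Type*} [AddCommGroup W] [Module ℝ W]
    [FiniteDimensional ℝ W] {n : ℕ} (hn : finrank ℝ W = n) (b : LinearMap.BilinForm ℝ W)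
    (hsymm : ∀ x y, b x y = b y x) (hpos : ∀ x, x ≠ 0 → 0 < b x x) :
    ∃ ε : EuclideanSpace ℝ (Fin n) ≃ₗ[ℝ] W, ∀ x y, b (ε x) (ε y) = inner ℝ x y := by
  let core : InnerProductSpace.Core ℝ W :=
    { inner := fun x y => b x y
      conj_inner_symm := fun x y => by simpa using hsymm y x
      re_inner_nonneg := fun x => by
        by_cases hx : x = 0
        · simp [hx]
        · simpa using (hpos x hx).le
      add_left := fun x y z => by simp
      smul_left := fun x y r => by simp
      definite := fun x hx => by
        by_contra h
        exact (hpos x h).ne' hx }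
  let _ : NormedAddCommGroup W := core.toNormedAddCommGroup
  let _ : InnerProductSpace ℝ W := InnerProductSpace.ofCore core.toCore
  let e := ((stdOrthonormalBasis ℝ W).reindex (finCongr hn)).repr.symm
  exact ⟨e.toLinearEquiv, fun x y => e.inner_map_map x y⟩

/-- The range of an injective map from `EuclideanSpace ℝ (Fin n)` into an `n`-dimensional
subspace is that subspace. -/
theorem range_eq_of_injective_of_finrank_eq {V : Type*} [AddCommGroup V] [Module ℝ V]
    [FiniteDimensional ℝ V] {n : ℕ} {L : Submodule ℝ V} (hL : finrank ℝ L = n)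
    (f : EuclideanSpace ℝ (Fin n) →ₗ[ℝ] V) (hf : Function.Injective f) (hmem : ∀ x, f x ∈ L) :
    LinearMap.range f = L := by
  apply Submodule.eq_of_le_of_finrank_eq
  · rintro _ ⟨x, rfl⟩
    exact hmem x
  · rw [LinearMap.finrank_range_of_inj hf, hL, finrank_euclideanSpace_fin]

/-- Symplectic coordinates adapted to a maximal triple `⟨P,Q,R⟩`: `P` and `R` become the two
coordinate Lagrangians and `Q` becomes the diagonal. -/
theorem MaslovMax.exists_adapted_coordinates {V : Type*} [AddCommGroup V] [Module ℝ V]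
    [FiniteDimensional ℝ V] {n : ℕ} (hdim : finrank ℝ V = 2 * n)
    {ω : LinearMap.BilinForm ℝ V} (halt : ∀ v : V, ω v v = 0) {P Q R : Submodule ℝ V}
    (hP : IsLagrangian ω n P) (hQ : IsLagrangian ω n Q) (hR : IsLagrangian ω n R)
    (h : MaslovMax ω P Q R) :
    ∃ φ : (EuclideanSpace ℝ (Fin n) × EuclideanSpace ℝ (Fin n)) ≃ₗ[ℝ] V,
      (∀ x y, ω (φ x) (φ y) = inner ℝ x.1 y.2 - inner ℝ x.2 y.1) ∧
      (LinearMap.range (LinearMap.inl ℝ _ _)).map φ.toLinearMap = P ∧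
      (LinearMap.range (LinearMap.id.prod LinearMap.id)).map φ.toLinearMap = Q ∧
      (LinearMap.range (LinearMap.inr ℝ _ _)).map φ.toLinearMap = R := by
  obtain ⟨hPR, Inv, hInvP, hInvR, hpos⟩ := h
  have hsup : P ⊔ R = ⊤ := by
    apply Submodule.eq_top_of_finrank_eq
    have := Submodule.finrank_sup_add_finrank_inf_eq P R
    rw [hPR, finrank_bot, hP.1, hR.1] at this
    omega
  let p : V →ₗ[ℝ] V := (1 / 2 : ℝ) • (LinearMap.id - Inv)
  let r : V →ₗ[ℝ] V := (1 / 2 : ℝ) • (LinearMap.id + Inv)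
  have hpr : ∀ v, p v ∈ P ∧ r v ∈ R := by
    intro v
    obtain ⟨x, hx, z, hz, rfl⟩ := Submodule.mem_sup.1 (hsup ▸ Submodule.mem_top : v ∈ P ⊔ R)
    have h1 : p (x + z) = x := by
      simp only [p, LinearMap.smul_apply, LinearMap.sub_apply, LinearMap.id_apply, map_add,
        hInvP x hx, hInvR z hz]
      module
    have h2 : r (x + z) = z := by
      simp only [r, LinearMap.smul_apply, LinearMap.add_apply, LinearMap.id_apply, map_add,
        hInvP x hx, hInvR z hz]
      module
    rw [h1, h2]
    exact ⟨hx, hz⟩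
  have hadd : ∀ v, p v + r v = v := fun v => by
    simp only [p, r, LinearMap.smul_apply, LinearMap.add_apply, LinearMap.sub_apply,
      LinearMap.id_apply]
    module
  have hInv : ∀ v, Inv v = r v - p v := fun v => by
    simp only [p, r, LinearMap.smul_apply, LinearMap.add_apply, LinearMap.sub_apply,
      LinearMap.id_apply]
    module
  have hskew : ∀ v w, ω v w = -ω w v := fun v w => ((LinearMap.IsAlt.neg halt w v)).symm
  have hpp : ∀ v w, ω (p v) (p w) = 0 := fun v w => hP.2 _ (hpr v).1 _ (hpr w).1
  have hrr : ∀ v w, ω (r v) (r w) = 0 := fun v w => hR.2 _ (hpr v).2 _ (hpr w).2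
  let b : LinearMap.BilinForm ℝ Q := ω.compl₁₂ (p ∘ₗ Q.subtype) (r ∘ₗ Q.subtype)
  have hb : ∀ x y : Q, b x y = ω (p x) (r y) := fun _ _ => rfl
  obtain ⟨ε, hε⟩ := exists_euclidean_isometry_of_posDef hQ.1 b
    (fun x y => by
      have hxy := hQ.2 x x.2 y y.2
      rw [← hadd x, ← hadd y] at hxy
      simp only [map_add, LinearMap.add_apply, hpp, hrr] at hxy
      rw [hb, hb]
      linarith [hskew (r x) (p y)])
    (fun x hx => by
      have hx' := hpos x x.2 (by simpa using hx)
      rw [hInv] at hx'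
      nth_rewrite 1 [← hadd x] at hx'
      simp only [map_add, map_sub, LinearMap.add_apply, hpp, hrr] at hx'
      rw [hb]
      linarith [hskew (r x) (p x)])
  let f : (EuclideanSpace ℝ (Fin n) × EuclideanSpace ℝ (Fin n)) →ₗ[ℝ] V :=
    (p ∘ₗ Q.subtype ∘ₗ ε.toLinearMap).coprod (r ∘ₗ Q.subtype ∘ₗ ε.toLinearMap)
  have hf : ∀ x, f x = p (ε x.1) + r (ε x.2) := fun _ => rfl
  have hform : ∀ x y, ω (f x) (f y) = inner ℝ x.1 y.2 - inner ℝ x.2 y.1 := by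
    intro x y
    rw [hf, hf, real_inner_comm y.1 x.2, ← hε, ← hε, hb, hb]
    simp only [map_add, LinearMap.add_apply, hpp, hrr]
    linarith [hskew (r (ε x.2)) (p (ε y.1))]
  have hinj : Function.Injective f := by
    rw [injective_iff_map_eq_zero]
    intro x hx
    have h1 := hform x (0, x.1)
    have h2 := hform x (x.2, 0)
    simp only [hx, map_zero, LinearMap.zero_apply, inner_zero_right, sub_zero, zero_sub] at h1 h2
    exact Prod.ext (inner_self_eq_zero.1 h1.symm) (inner_self_eq_zero.1 (neg_eq_zero.1 h2.symm))
  let φ := LinearEquiv.ofInjectiveOfFinrankEq f hinj (by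
    rw [finrank_prod, finrank_euclideanSpace_fin, hdim, two_mul])
  have hφ : φ.toLinearMap = f := rfl
  refine ⟨φ, hform, ?_, ?_, ?_⟩
  · rw [← LinearMap.range_comp, hφ]
    refine range_eq_of_injective_of_finrank_eq hP.1 _
      (hinj.comp LinearMap.inl_injective) fun x => ?_
    simpa [hf] using (hpr (ε x)).1
  · rw [← LinearMap.range_comp, hφ]
    refine range_eq_of_injective_of_finrank_eq hQ.1 _
      (hinj.comp fun x y hxy => congrArg Prod.fst hxy) fun x => ?_
    simp [hf, hadd]
  · rw [← LinearMap.range_comp, hφ]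
    refine range_eq_of_injective_of_finrank_eq hR.1 _
      (hinj.comp LinearMap.inr_injective) fun x => ?_
    simpa [hf] using (hpr (ε x)).2

/-- the symplectic group acts transitively on triples of Lagrangians with
maximal Maslov index. -/
theorem symplectic_transitive_on_maximal_triples {V : Type*} [AddCommGroup V] [Module ℝ V]
    [FiniteDimensional ℝ V]
    (n : ℕ) (hn : 1 ≤ n) (hdim : finrank ℝ V = 2 * n)
    (ω : LinearMap.BilinForm ℝ V)
    (halt : ∀ v : V, ω v v = 0)
    (hnd : ∀ v : V, (∀ w : V, ω v w = 0) → v = 0)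
    (P Q R P' Q' R' : Submodule ℝ V)
    (hP : IsLagrangian ω n P) (hQ : IsLagrangian ω n Q) (hR : IsLagrangian ω n R)
    (hP' : IsLagrangian ω n P') (hQ' : IsLagrangian ω n Q') (hR' : IsLagrangian ω n R')
    (h : MaslovMax ω P Q R) (h' : MaslovMax ω P' Q' R') :
    ∃ g : V ≃ₗ[ℝ] V, (∀ v w : V, ω (g v) (g w) = ω v w) ∧
      P.map g.toLinearMap = P' ∧ Q.map g.toLinearMap = Q' ∧ R.map g.toLinearMap = R' := by
  obtain ⟨φ, hφ, rfl, rfl, rfl⟩ := h.exists_adapted_coordinates hdim halt hP hQ hR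
  obtain ⟨ψ, hψ, rfl, rfl, rfl⟩ := h'.exists_adapted_coordinates hdim halt hP' hQ' hR'
  have hmap : ∀ S : Submodule ℝ (EuclideanSpace ℝ (Fin n) × EuclideanSpace ℝ (Fin n)),
      (S.map φ.toLinearMap).map (φ.symm.trans ψ).toLinearMap = S.map ψ.toLinearMap := fun S => by
    rw [← Submodule.map_comp]
    congr 1
    ext x <;> simp
  refine ⟨φ.symm.trans ψ, fun v w => ?_, hmap _, hmap _, hmap _⟩
  rw [LinearEquiv.trans_apply, LinearEquiv.trans_apply, hψ, ← hφ, φ.apply_symm_apply,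
    φ.apply_symm_apply]
end
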